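/- Let ℂⁿ = H_S ⊕ H_C ⊕ H_Z be an orthogonal decomposition with orthogonal projections Π_S, Π_C, Π_Z. Let H ∈ M_n(ℂ) be Hermitian and L_1, …, L_r ∈ M_n(ℂ) with Π_S L_k Π_C = 0 and Π_S L_k Π_Z = 0 for every k, and Lindblad generator 𝓛. Assume that for every density matrix ρ with Π_Z ρ Π_Z = ρ, at least one of the following holds: (a) Σ_k (Π_C L_k Π_Z) ρ (Π_C L_k Π_Z)† ≠ 0, or (b) −i·(Π_C H Π_Z)·ρ + Σ_k [ (Π_C L_k Π_Z) ρ (Π_Z L_k† Π_Z) − (1/2)·((Π_C L_k Π_C)† (Π_C L_k Π_Z) + (Π_C L_k† Π_Z)(Π_Z L_k Π_Z)) · ρ ] ≠ 0. Then there is no nonempty set X of density matrices, each supported in H_Z, such that exp(t𝓛)(ρ) ∈ X for every ρ ∈ X and every t ≥ 0. -/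

import Mathlib

open scoped Matrix ComplexOrder

noncomputable section

attribute [local instance] Matrix.normedAddCommGroup Matrix.normedSpace

abbrev Mat (n : ℕ) := Matrix (Fin n) (Fin n) ℂ

/-- The Lindblad generator `𝓛(ρ) = −i[H,ρ] + Σ_k (L_k ρ L_k† − ½(L_k† L_k ρ + ρ L_k† L_k))`. -/
def lindblad {n r : ℕ} (H : Mat n) (L : Fin r → Mat n) : Mat n →ₗ[ℂ] Mat n :=
  (-Complex.I) • (LinearMap.mulLeft ℂ H - LinearMap.mulRight ℂ H)
    + ∑ k, ((LinearMap.mulRight ℂ (L k)ᴴ).comp (LinearMap.mulLeft ℂ (L k))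
        - (1/2 : ℂ) • (LinearMap.mulLeft ℂ ((L k)ᴴ * L k)
            + LinearMap.mulRight ℂ ((L k)ᴴ * L k)))

/-- `evol H L t ρ = exp (t 𝓛) ρ`, the solution of the master equation at time `t`. -/
def evol {n r : ℕ} (H : Mat n) (L : Fin r → Mat n) (t : ℝ) (ρ : Mat n) : Mat n :=
  have : IsTopologicalRing (Mat n →L[ℂ] Mat n) :=
    @NonUnitalSeminormedRing.toIsTopologicalRing _
      (ContinuousLinearMap.toSeminormedRing (𝕜 := ℂ) (E := Mat n)).toNonUnitalSeminormedRing
  NormedSpace.exp ((t : ℂ) • (lindblad H L).toContinuousLinearMap) ρ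

lemma lindblad_apply {n r : ℕ} (H : Mat n) (L : Fin r → Mat n) (ρ : Mat n) :
    lindblad H L ρ = (-Complex.I) • (H * ρ - ρ * H)
      + ∑ k, (L k * ρ * (L k)ᴴ
          - (1/2 : ℂ) • ((L k)ᴴ * L k * ρ + ρ * ((L k)ᴴ * L k))) := by
  simp [lindblad, LinearMap.sum_apply, mul_assoc]

lemma hasDerivAt_exp_smul_apply_zero {E : Type*} [NormedAddCommGroup E] [NormedSpace ℂ E]
    [CompleteSpace E] (A : E →L[ℂ] E) (x : E) :
    HasDerivAt (fun t : ℝ => NormedSpace.exp ((t : ℂ) • A) x) (A x) 0 := by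
  have h := hasDerivAt_exp_smul_const (𝕂 := ℂ) A ((0 : ℝ) : ℂ)
  have h' := ((ContinuousLinearMap.apply ℂ E x).hasFDerivAt.comp_hasDerivAt _ h).scomp (0 : ℝ)
    Complex.ofRealCLM.hasDerivAt
  simpa [Function.comp_def, NormedSpace.exp_zero] using h'

lemma hasDerivAt_evol_zero {n r : ℕ} (H : Mat n) (L : Fin r → Mat n) (ρ : Mat n) :
    HasDerivAt (fun t : ℝ => evol H L t ρ) (lindblad H L ρ) 0 :=
  hasDerivAt_exp_smul_apply_zero (E := Mat n) (lindblad H L).toContinuousLinearMap ρ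

/-- A linear map that vanishes along the forward evolution of `ρ` also vanishes
on the generator at `ρ`. -/
lemma apply_lindblad_eq_zero {n r : ℕ} (H : Mat n) (L : Fin r → Mat n) (ρ : Mat n)
    (f : Mat n →ₗ[ℂ] Mat n) (hf : ∀ t : ℝ, 0 ≤ t → f (evol H L t ρ) = 0) :
    f (lindblad H L ρ) = 0 := by
  have h := ((f.toContinuousLinearMap.restrictScalars ℝ).hasFDerivAt.comp_hasDerivAt (0 : ℝ)
    (hasDerivAt_evol_zero H L ρ)).hasDerivWithinAt (s := Set.Ici 0)
  have h0 : HasDerivWithinAt (fun _ : ℝ => (0 : Mat n)) 0 (Set.Ici 0) 0 :=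
    hasDerivWithinAt_const _ _ _
  exact (uniqueDiffWithinAt_Ici (0 : ℝ)).eq_deriv _ h
    (h0.congr (fun t ht => hf t ht) (hf 0 le_rfl))

/-- Under the block conditions on the noise operators, if for every
density matrix supported in `H_Z` either the `C`-block or the `C–Z`-block expression of
the generator is nonzero, then there is no nonempty invariant set of density matrices
supported in `H_Z`. -/
theorem no_invariant_set_in_Z {n r : ℕ}
    (PS PC PZ : Mat n)
    (hSH : PS.IsHermitian) (hCH : PC.IsHermitian) (hZH : PZ.IsHermitian)
    (hSidem : PS * PS = PS) (hCidem : PC * PC = PC) (hZidem : PZ * PZ = PZ)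
    (hSC : PS * PC = 0) (hSZ : PS * PZ = 0) (hCZ : PC * PZ = 0)
    (hsum : PS + PC + PZ = 1)
    (H : Mat n) (hH : H.IsHermitian) (L : Fin r → Mat n)
    (hLC : ∀ k, PS * L k * PC = 0) (hLZ : ∀ k, PS * L k * PZ = 0)
    (hcond : ∀ ρ : Mat n, ρ.PosSemidef → ρ.trace = 1 → PZ * ρ * PZ = ρ →
      (∑ k, (PC * L k * PZ) * ρ * (PC * L k * PZ)ᴴ ≠ 0) ∨
      ((-Complex.I) • (PC * H * PZ * ρ) +
          ∑ k, ((PC * L k * PZ) * ρ * (PZ * (L k)ᴴ * PZ) -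
            (1/2 : ℂ) • (((PC * L k * PC)ᴴ * (PC * L k * PZ) +
              (PC * (L k)ᴴ * PZ) * (PZ * L k * PZ)) * ρ)) ≠ 0)) :
    ¬ ∃ X : Set (Mat n), X.Nonempty ∧
        (∀ ρ ∈ X, ρ.PosSemidef ∧ ρ.trace = 1 ∧ PZ * ρ * PZ = ρ) ∧
        (∀ ρ ∈ X, ∀ t : ℝ, 0 ≤ t → evol H L t ρ ∈ X) := by
  rintro ⟨X, ⟨ρ, hρX⟩, hX, hinv⟩
  obtain ⟨hpos, htr, hρ⟩ := hX ρ hρX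
  have hZC : PZ * PC = 0 := by
    simpa [hCH.eq, hZH.eq] using congrArg Matrix.conjTranspose hCZ
  have hgen : PC * lindblad H L ρ = 0 := by
    refine apply_lindblad_eq_zero H L ρ (LinearMap.mulLeft ℂ PC) fun t ht => ?_
    rw [LinearMap.mulLeft_apply, ← (hX _ (hinv ρ hρX t ht)).2.2, ← mul_assoc, ← mul_assoc, hCZ,
      zero_mul, zero_mul]
  have hCρ : PC * ρ = 0 := by rw [← hρ, ← mul_assoc, ← mul_assoc, hCZ, zero_mul, zero_mul]
  have hρC : ρ * PC = 0 := by rw [← hρ, mul_assoc, hZC, mul_zero]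
  have hZρ : PZ * ρ = ρ := by rw [← hρ, ← mul_assoc, ← mul_assoc, hZidem]
  have hρZ : ρ * PZ = ρ := by rw [← hρ, mul_assoc, hZidem]
  have hCρ' (A : Mat n) : PC * (ρ * A) = 0 := by rw [← mul_assoc, hCρ, zero_mul]
  have hZρ' (A : Mat n) : PZ * (ρ * A) = ρ * A := by rw [← mul_assoc, hZρ]
  have hρZ' (A : Mat n) : ρ * (PZ * A) = ρ * A := by rw [← mul_assoc, hρZ]
  have hCC' (A : Mat n) : PC * (PC * A) = PC * A := by rw [← mul_assoc, hCidem]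
  have hZZ' (A : Mat n) : PZ * (PZ * A) = PZ * A := by rw [← mul_assoc, hZidem]
  have hLρ (k : Fin r) : L k * ρ = PC * (L k * ρ) + PZ * (L k * ρ) := by
    have hS : PS * (L k * ρ) = 0 := by
      rw [← hZρ, ← mul_assoc, ← mul_assoc, hLZ, zero_mul]
    calc L k * ρ = (PS + PC + PZ) * (L k * ρ) := by rw [hsum, one_mul]
      _ = _ := by rw [add_mul, add_mul, hS, zero_add]
  rw [lindblad_apply] at hgen
  rcases hcond ρ hpos htr hρ with h | h
  · apply h
    have hCC := congrArg (· * PC) hgen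
    simpa [mul_add, add_mul, mul_sub, sub_mul, Finset.mul_sum, Finset.sum_mul, mul_assoc,
      hρC, hCρ', hZρ', hρZ', hCH.eq, hZH.eq] using hCC
  · apply h
    have hCZblock := congrArg (· * PZ) hgen
    simp only [mul_add, add_mul, mul_sub, sub_mul, Finset.mul_sum, Finset.sum_mul, mul_assoc,
      hρZ, hCρ', zero_mul, Matrix.mul_smul, Matrix.smul_mul, sub_zero, add_zero]
      at hCZblock
    rw [← hCZblock]
    congr 1
    · simp [mul_assoc, hZρ]
    · refine Finset.sum_congr rfl fun k _ => ?_
      rw [hLρ k]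
      simp [mul_assoc, mul_add, add_mul, hZρ, hρZ', hCC', hZZ', hCH.eq]
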